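/- arXiv:1405.2742 — 3 statements merged into one kernel-verified Lean document; each statement's English description precedes it below -/
import Mathlib

section
/- Let d ≥ 2 and p ∈ (2,∞). There is a constant C(p) < ∞ such that for all δ ∈ (0,1], all v, v_* ∈ ℝ^d with v ≠ v_* and |v_*| ≤ |v|, and all σ ∈ S^{d−1} with σ ∉ {−u, u} where u = (v − v_*)/|v − v_*|, one has |v′|^p + |v′_*|^p − |v|^p − |v_*|^p ≤ −β(δ,t) (|v|^p + |v_*|^p) + C(p) δ^{−1} (|v| |v_*|^{p−1} + |v|^{p−1} |v_*|), where t = (1 + u·σ)/2 ∈ (0,1) and β(δ,t) = (1 − (1+δ)^{p+1} (t^{p/2} + (1−t)^{p/2}))⁺ / 2. -/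
open MeasureTheory ProbabilityTheory Filter
open scoped ENNReal NNReal RealInnerProductSpace

noncomputable section

abbrev Vd (d : ℕ) := EuclideanSpace ℝ (Fin d)

namespace KacModel

variable {d : ℕ}

/-- Post-collision velocity `v' = (v+v*)/2 + |v-v*|σ/2`. -/
def postV (v vs σ : Vd d) : Vd d := (2:ℝ)⁻¹ • (v + vs) + ((2:ℝ)⁻¹ * ‖v - vs‖) • σ

/-- Post-collision velocity `v'_* = (v+v*)/2 - |v-v*|σ/2`. -/
def postVs (v vs σ : Vd d) : Vd d := (2:ℝ)⁻¹ • (v + vs) - ((2:ℝ)⁻¹ * ‖v - vs‖) • σ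

/-- The unit sphere `S^{d-1}` regarded as a subset of `ℝ^d`. -/
def unitSphere (d : ℕ) : Set (Vd d) := {σ | ‖σ‖ = 1}

/-- Standing assumptions (1.1) on a collision kernel, regarded as a family of
measures on `ℝ^d` carried by the unit sphere. -/
structure IsCollisionKernel (B : Vd d → Measure (Vd d)) : Prop where
  measurable : ∀ s : Set (Vd d), MeasurableSet s → Measurable fun v => B v s
  prob : ∀ u : Vd d, ‖u‖ = 1 → IsProbabilityMeasure (B u)
  support : ∀ u : Vd d, ‖u‖ = 1 → B u ((unitSphere d \ {u, -u})ᶜ) = 0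
  scaling : ∀ (c : ℝ), 0 ≤ c → ∀ u : Vd d, ‖u‖ = 1 →
    B (c • u) = ENNReal.ofReal c • B u
  symm : ∀ (R : Vd d ≃ₗᵢ[ℝ] Vd d) (u : Vd d), ‖u‖ = 1 → B (R u) = (B u).map R

/-- Total variation distance between two finite measures (dual formulation). -/
def tvDist {E : Type*} [MeasurableSpace E] (μ ν : Measure E) : ℝ :=
  ⨆ f : {f : E → ℝ // Measurable f ∧ ∀ x, |f x| ≤ 1},
    ((∫ x, f.1 x ∂μ) - ∫ x, f.1 x ∂ν)

/-- The Lipschitz assumption (1.2). -/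
def IsLipschitzKernel (B : Vd d → Measure (Vd d)) (κ : ℝ) : Prop :=
  1 ≤ κ ∧ ∀ v v' : Vd d, tvDist (B v) (B v') ≤ κ * ‖v - v'‖

/-- The Boltzmann sphere 𝒮. -/
def boltzmannSphere (d : ℕ) : Set (Measure (Vd d)) :=
  {μ | IsProbabilityMeasure μ ∧ (∫ v, v ∂μ) = 0 ∧ (∫ v, ‖v‖ ^ 2 ∂μ) = 1}

/-- 𝒮_N : normalized empirical measures in the Boltzmann sphere. -/
def empiricalSphere (d N : ℕ) : Set (Measure (Vd d)) :=
  {μ | μ ∈ boltzmannSphere d ∧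
    ∃ x : Fin N → Vd d, μ = (N : ℝ≥0∞)⁻¹ • ∑ i, Measure.dirac (x i)}

/-- The class ℱ of test functions. -/
def testF (d : ℕ) : Set (Vd d → ℝ) :=
  {f | (∀ v, |f v / (1 + ‖v‖ ^ 2)| ≤ 1) ∧
    ∀ v v', |f v / (1 + ‖v‖ ^ 2) - f v' / (1 + ‖v'‖ ^ 2)| ≤ ‖v - v'‖}

/-- The weighted Wasserstein distance W. -/
def Wdist (μ ν : Measure (Vd d)) : ℝ :=
  ⨆ f : testF d, ((∫ v, (f : Vd d → ℝ) v ∂μ) - ∫ v, (f : Vd d → ℝ) v ∂ν)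

/-- The p-th moment `∫ |v|^p dμ`, as a lower integral. -/
def momentL (p : ℝ) (μ : Measure (Vd d)) : ℝ≥0∞ :=
  ∫⁻ v, (‖v‖₊ : ℝ≥0∞) ^ p ∂μ

/-- Total variation measure |μ - ν| of the difference of two finite measures. -/
def tvMeasure {E : Type*} [MeasurableSpace E] (μ ν : Measure E) : Measure E :=
  (μ - ν) + (ν - μ)

/-- The post-collision update `μ^{v,v_*,σ}` of an empirical measure. -/
def collUpdate (N : ℕ) (μ : Measure (Vd d)) (v vs σ : Vd d) : Measure (Vd d) :=
  μ + (N : ℝ≥0∞)⁻¹ • (Measure.dirac (postV v vs σ) + Measure.dirac (postVs v vs σ))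
    - (N : ℝ≥0∞)⁻¹ • (Measure.dirac v + Measure.dirac vs)

/-- The generator 𝒢 of the Kac process. -/
def kacGen (B : Vd d → Measure (Vd d)) (N : ℕ) (F : Measure (Vd d) → ℝ)
    (μ : Measure (Vd d)) : ℝ :=
  N * ∫ v, (∫ vs, (∫ σ, (F (collUpdate N μ v vs σ) - F μ) ∂(B (v - vs))) ∂μ) ∂μ

/-- A Kac process with collision kernel `B` and particle number `N`:
a càdlàg adapted 𝒮_N-valued process solving the martingale problem for 𝒢. -/
structure IsKacProcess {Ω : Type*} [m : MeasurableSpace Ω]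
    (B : Vd d → Measure (Vd d)) (N : ℕ) (P : Measure Ω)
    (𝓕 : Filtration ℝ m) (μp : ℝ → Ω → Measure (Vd d)) : Prop where
  mem : ∀ t ω, μp t ω ∈ empiricalSphere d N
  adapted : ∀ f ∈ testF d, StronglyAdapted 𝓕 fun t ω => ∫ v, f v ∂(μp t ω)
  rightCont : ∀ ω, ∀ f ∈ testF d, ∀ t : ℝ,
    ContinuousWithinAt (fun s => ∫ v, f v ∂(μp s ω)) (Set.Ici t) t
  leftLim : ∀ ω, ∀ f ∈ testF d, ∀ t : ℝ, 0 < t →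
    ∃ L : ℝ, Tendsto (fun s => ∫ v, f v ∂(μp s ω)) (nhdsWithin t (Set.Iio t)) (nhds L)
  martingale : ∀ G : Measure (Vd d) → ℝ, Measurable G → (∃ M : ℝ, ∀ ν, |G ν| ≤ M) →
    Martingale (fun t ω => G (μp t ω) - ∫ s in Set.Ioc (0:ℝ) t, kacGen B N G (μp s ω)) 𝓕 P

/-- `⟨f, Q(μ,ν)⟩`, the Boltzmann collision integral. -/
def QInt (B : Vd d → Measure (Vd d)) (f : Vd d → ℝ) (μ ν : Measure (Vd d)) : ℝ :=
  ∫ v, (∫ vs, (∫ σ, (f (postV v vs σ) + f (postVs v vs σ) - f v - f vs) ∂(B (v - vs))) ∂ν) ∂μ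

/-- Measure solution of the spatially homogeneous Boltzmann equation, started at time τ. -/
def IsBoltzmannSolutionFrom (B : Vd d → Measure (Vd d)) (τ : ℝ)
    (μt : ℝ → Measure (Vd d)) : Prop :=
  (∀ t, τ ≤ t → μt t ∈ boltzmannSphere d) ∧
  ∀ f : Vd d → ℝ, Measurable f → (∃ M, ∀ v, |f v| ≤ M) → HasCompactSupport f →
    ∀ t, τ ≤ t →
      (∫ v, f v ∂(μt t)) = (∫ v, f v ∂(μt τ)) + ∫ s in Set.Ioc τ t, QInt B f (μt s) (μt s)

/-- Measure solution of the spatially homogeneous Boltzmann equation (start time 0). -/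
def IsBoltzmannSolution (B : Vd d → Measure (Vd d)) (μt : ℝ → Measure (Vd d)) : Prop :=
  IsBoltzmannSolutionFrom B 0 μt

/-- Local boundedness in 𝒮(p) from time τ on. -/
def LocBddMomentFrom (p τ : ℝ) (μt : ℝ → Measure (Vd d)) : Prop :=
  ∀ T, τ ≤ T → ∃ M : ℝ≥0∞, M ≠ ⊤ ∧ ∀ t ∈ Set.Icc τ T, momentL p (μt t) ≤ M

/-- Sample mean. -/
def sampleMean {Ω : Type*} {N : ℕ} (Vs : Fin N → Ω → Vd d) (ω : Ω) : Vd d :=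
  (N : ℝ)⁻¹ • ∑ i, Vs i ω

/-- Sample mean square. -/
def sampleQ {Ω : Type*} {N : ℕ} (Vs : Fin N → Ω → Vd d) (ω : Ω) : ℝ :=
  (N : ℝ)⁻¹ * ∑ i, ‖Vs i ω‖ ^ 2

/-- Sample variance. -/
def sampleS {Ω : Type*} {N : ℕ} (Vs : Fin N → Ω → Vd d) (ω : Ω) : ℝ :=
  sampleQ Vs ω - ‖sampleMean Vs ω‖ ^ 2

/-- The rescaled empirical distribution μ̃^N. -/
def rescaledEmpirical {Ω : Type*} {N : ℕ} (Vs : Fin N → Ω → Vd d)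
    (μdef : Measure (Vd d)) (ω : Ω) : Measure (Vd d) :=
  if 0 < sampleS Vs ω then
    (N : ℝ≥0∞)⁻¹ • ∑ i, Measure.dirac
      ((Real.sqrt (sampleS Vs ω))⁻¹ • (Vs i ω - sampleMean Vs ω))
  else μdef

/-- The N-sample empirical distribution. -/
def empMeasure {Ω : Type*} {N : ℕ} (Vs : Fin N → Ω → Vd d) (ω : Ω) : Measure (Vd d) :=
  (N : ℝ≥0∞)⁻¹ • ∑ i, Measure.dirac (Vs i ω)

end KacModel

open KacModel

lemma povz_aux (q x y a b : ℝ) (hq : 1 < q) (ha : 0 < a) (hx : 0 ≤ x) (hy : 0 ≤ y)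
    (hb : 0 ≤ b) (h5 : x + y ≤ 5 * a ^ 2) (hyb : y ≤ 3 * (a * b)) :
    (x + y) ^ q ≤ x ^ q + 3 * q * (5:ℝ) ^ (q - 1) * (a ^ (2 * q - 1) * b) := by
  have hK : 0 ≤ 3 * q * (5:ℝ) ^ (q - 1) * (a ^ (2 * q - 1) * b) := by positivity
  rcases eq_or_lt_of_le (add_nonneg hx hy) with hz | hz
  · rw [← hz, Real.zero_rpow (by linarith)]
    have : 0 ≤ x ^ q := by positivity
    linarith
  · have h1 := one_add_mul_self_le_rpow_one_add (s := x / (x + y) - 1) (p := q)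
      (by have : 0 ≤ x / (x + y) := by positivity
          linarith) hq.le
    have e1 : 1 + (x / (x + y) - 1) = x / (x + y) := by ring
    rw [e1, Real.div_rpow hx hz.le] at h1
    have hzq : 0 < (x + y) ^ q := by positivity
    rw [le_div_iff₀ hzq] at h1
    have e2 : (x + y) ^ q = (x + y) ^ (q - 1) * (x + y) := by
      rw [Real.rpow_sub_one hz.ne']; field_simp
    have e3 : (1 + q * (x / (x + y) - 1)) * (x + y) ^ q
        = (x + y) ^ q - q * y * (x + y) ^ (q - 1) := by
      have : (x / (x + y) - 1) * (x + y) = - y := by field_simp; ring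
      rw [e2]
      linear_combination q * (x + y) ^ (q - 1) * this
    rw [e3] at h1
    have h2 : (x + y) ^ (q - 1) ≤ (5 * a ^ 2) ^ (q - 1) :=
      Real.rpow_le_rpow hz.le h5 (by linarith)
    have e4 : (5 * a ^ 2) ^ (q - 1) * a = (5:ℝ) ^ (q - 1) * a ^ (2 * q - 1) := by
      rw [Real.mul_rpow (by norm_num) (by positivity), ← Real.rpow_natCast a 2,
        ← Real.rpow_mul ha.le, mul_assoc, ← Real.rpow_add_one ha.ne']
      congr 2
      push_cast; ring
    have h3 : q * y * (x + y) ^ (q - 1) ≤ q * (3 * (a * b)) * (5 * a ^ 2) ^ (q - 1) := by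
      gcongr
    have e5 : q * (3 * (a * b)) * (5 * a ^ 2) ^ (q - 1)
        = 3 * q * (5:ℝ) ^ (q - 1) * (a ^ (2 * q - 1) * b) := by
      linear_combination 3 * q * b * e4
    linarith

lemma povz_one (q x N a b : ℝ) (hq : 1 < q) (ha : 0 < a) (hx : 0 ≤ x) (hN : 0 ≤ N)
    (hb : 0 ≤ b) (hba : b ≤ a) (hxa : x ≤ a ^ 2 + b ^ 2) (h : N ^ 2 ≤ x + 3 * (a * b)) :
    N ^ (2 * q) ≤ x ^ q + 3 * q * (5:ℝ) ^ (q - 1) * (a ^ (2 * q - 1) * b) := by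
  have h1 := povz_aux q x (3 * (a * b)) a b hq ha hx (by positivity) hb (by nlinarith) le_rfl
  refine le_trans ?_ h1
  rw [Real.rpow_mul hN]
  refine Real.rpow_le_rpow (by positivity) ?_ (by linarith)
  rw [show (2:ℝ) = ((2:ℕ):ℝ) by norm_num, Real.rpow_natCast]
  exact_mod_cast h

lemma povz_real (q a b t N M : ℝ) (hq : 1 < q) (ha : 0 < a) (hb : 0 ≤ b) (hba : b ≤ a)
    (ht : 0 < t) (ht1 : t < 1) (hN : 0 ≤ N) (hM : 0 ≤ M)
    (h1 : N ^ 2 ≤ t * (a ^ 2 + b ^ 2) + 3 * (a * b))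
    (h2 : M ^ 2 ≤ (1 - t) * (a ^ 2 + b ^ 2) + 3 * (a * b)) (δ : ℝ) (hδ : 0 < δ) (hδ1 : δ ≤ 1) :
    N ^ (2 * q) + M ^ (2 * q) - a ^ (2 * q) - b ^ (2 * q) ≤
      -(max (1 - (1 + δ) ^ (2 * q + 1) * (t ^ q + (1 - t) ^ q)) 0 / 2)
        * (a ^ (2 * q) + b ^ (2 * q)) +
      (9 * q * (5:ℝ) ^ (q - 1)) * δ⁻¹ * (a * b ^ (2 * q - 1) + a ^ (2 * q - 1) * b) := by
  have ht' : 0 < 1 - t := by linarith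
  have hE : 0 ≤ a ^ 2 + b ^ 2 := by positivity
  have k1 := povz_one q (t * (a ^ 2 + b ^ 2)) N a b hq ha (by positivity) hN hb hba
    (by nlinarith) h1
  have k2 := povz_one q ((1 - t) * (a ^ 2 + b ^ 2)) M a b hq ha (by positivity) hM hb hba
    (by nlinarith) h2
  have k3 := povz_aux q (a ^ 2) (b ^ 2) a b hq ha (by positivity) (by positivity) hb
    (by nlinarith) (by nlinarith)
  rw [Real.mul_rpow ht.le hE] at k1
  rw [Real.mul_rpow ht'.le hE] at k2
  have ea : (a ^ 2) ^ q = a ^ (2 * q) := by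
    rw [Real.rpow_mul ha.le]; norm_num
  rw [ea] at k3
  have s1 : t ^ q ≤ t := by
    simpa using Real.rpow_le_rpow_of_exponent_ge ht ht1.le hq.le
  have s2 : (1 - t) ^ q ≤ 1 - t := by
    simpa using Real.rpow_le_rpow_of_exponent_ge ht' (by linarith) hq.le
  have p1 : 0 ≤ t ^ q := by positivity
  have p2 : 0 ≤ (1 - t) ^ q := by positivity
  have hδp : 1 ≤ (1 + δ) ^ (2 * q + 1) := Real.one_le_rpow (by linarith) (by linarith)
  have hδi : 1 ≤ δ⁻¹ := (one_le_inv₀ hδ).2 hδ1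
  have hA : 0 ≤ a ^ (2 * q) := by positivity
  have hB : 0 ≤ b ^ (2 * q) := by positivity
  have hD : 0 ≤ a * b ^ (2 * q - 1) := by positivity
  have hK : 0 ≤ 3 * q * (5:ℝ) ^ (q - 1) * (a ^ (2 * q - 1) * b) := by positivity
  have hK' : 0 ≤ 9 * q * (5:ℝ) ^ (q - 1) := by positivity
  have hD2 : 0 ≤ a ^ (2 * q - 1) * b := by positivity
  set s := t ^ q + (1 - t) ^ q with hs
  have hs0 : 0 ≤ s := by positivity
  have hs1 : s ≤ 1 := by linarith
  have hβ : max (1 - (1 + δ) ^ (2 * q + 1) * s) 0 / 2 ≤ 1 - s := by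
    have : max (1 - (1 + δ) ^ (2 * q + 1) * s) 0 ≤ 1 - s :=
      max_le (by nlinarith) (by linarith)
    linarith
  have m1 := mul_le_mul_of_nonneg_right hβ (add_nonneg hA hB)
  have m2 : (9 * q * (5:ℝ) ^ (q - 1)) * (a ^ (2 * q - 1) * b) ≤
      (9 * q * (5:ℝ) ^ (q - 1)) * δ⁻¹ * (a * b ^ (2 * q - 1) + a ^ (2 * q - 1) * b) := by
    apply mul_le_mul _ (by linarith) hD2 (by positivity)
    exact le_mul_of_one_le_right hK' hδi
  have m3 := mul_le_mul_of_nonneg_left k3 hs0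
  have m4 := mul_le_mul_of_nonneg_right hs1 hK
  have m5 := mul_nonneg hs0 hB
  have m6 : t ^ q * (a ^ 2 + b ^ 2) ^ q + (1 - t) ^ q * (a ^ 2 + b ^ 2) ^ q
    = s * (a ^ 2 + b ^ 2) ^ q := by rw [hs]; ring
  linarith

/-- The pointwise Povzner-type inequality (3.3). -/
theorem pointwise_povzner
    (d : ℕ) (hd : 2 ≤ d) (p : ℝ) (hp : 2 < p) :
    ∃ C : ℝ, 0 ≤ C ∧
      ∀ δ : ℝ, 0 < δ → δ ≤ 1 →
      ∀ v vs : Vd d, v ≠ vs → ‖vs‖ ≤ ‖v‖ →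
      ∀ σ : Vd d, ‖σ‖ = 1 →
        σ ≠ ‖v - vs‖⁻¹ • (v - vs) → σ ≠ -(‖v - vs‖⁻¹ • (v - vs)) →
        (0 < (1 + (inner ℝ (‖v - vs‖⁻¹ • (v - vs)) σ : ℝ)) / 2) ∧
        ((1 + (inner ℝ (‖v - vs‖⁻¹ • (v - vs)) σ : ℝ)) / 2 < 1) ∧
        (‖postV v vs σ‖ ^ p + ‖postVs v vs σ‖ ^ p - ‖v‖ ^ p - ‖vs‖ ^ p ≤
          -(max (1 - (1 + δ) ^ (p + 1) *
              (((1 + (inner ℝ (‖v - vs‖⁻¹ • (v - vs)) σ : ℝ)) / 2) ^ (p / 2) +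
               (1 - (1 + (inner ℝ (‖v - vs‖⁻¹ • (v - vs)) σ : ℝ)) / 2) ^ (p / 2))) 0 / 2) *
            (‖v‖ ^ p + ‖vs‖ ^ p) +
          C * δ⁻¹ * (‖v‖ * ‖vs‖ ^ (p - 1) + ‖v‖ ^ (p - 1) * ‖vs‖)) := by
  refine ⟨9 * (p / 2) * (5:ℝ) ^ (p / 2 - 1), by positivity, ?_⟩
  intro δ hδ hδ1 v vs hne hle σ hσ hσ1 hσ2
  have hw : 0 < ‖v - vs‖ := norm_pos_iff.2 (sub_ne_zero.2 hne)
  have hv : 0 < ‖v‖ := by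
    rcases eq_or_lt_of_le (norm_nonneg v) with h | h
    · exfalso
      have h2 : vs = 0 := norm_le_zero_iff.1 (by linarith)
      have h3 : v = 0 := norm_le_zero_iff.1 (by linarith)
      exact hne (by rw [h2, h3])
    · exact h
  have hu : ‖‖v - vs‖⁻¹ • (v - vs)‖ = 1 := by
    rw [norm_smul, norm_inv, norm_norm, inv_mul_cancel₀ hw.ne']
  have hwu : v - vs = ‖v - vs‖ • (‖v - vs‖⁻¹ • (v - vs)) := by
    rw [smul_smul, mul_inv_cancel₀ hw.ne', one_smul]
  generalize ‖v - vs‖⁻¹ • (v - vs) = u at *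
  have hc := abs_le.1 (abs_real_inner_le_norm u σ)
  rw [hu, hσ] at hc
  have hlt : (inner ℝ u σ : ℝ) < 1 := by
    refine lt_of_le_of_ne (by linarith [hc.2]) fun h => hσ1 ?_
    exact ((inner_eq_one_iff_of_norm_eq_one hu hσ).1 h).symm
  have hgt : -1 < (inner ℝ u σ : ℝ) := by
    refine lt_of_le_of_ne (by linarith [hc.1]) fun h => hσ2 ?_
    have : (inner ℝ (-u) σ : ℝ) = 1 := by rw [inner_neg_left, ← h]; norm_num
    exact ((inner_eq_one_iff_of_norm_eq_one (by rw [norm_neg, hu]) hσ).1 this).symm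
  have ht : 0 < (1 + (inner ℝ u σ : ℝ)) / 2 := by linarith
  have ht1 : (1 + (inner ℝ u σ : ℝ)) / 2 < 1 := by linarith
  refine ⟨ht, ht1, ?_⟩
  have hw2 : ‖v - vs‖ ≤ 2 * ‖v‖ := by linarith [norm_sub_le v vs]
  have hvv := abs_le.1 (abs_real_inner_le_norm v vs)
  have hvσ := abs_le.1 (abs_real_inner_le_norm vs σ)
  rw [hσ, mul_one] at hvσ
  have e1 : ‖v - vs‖ ^ 2 = ‖v‖ ^ 2 - 2 * inner ℝ v vs + ‖vs‖ ^ 2 := norm_sub_sq_real v vs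
  have e2 : ‖v + vs‖ ^ 2 = ‖v‖ ^ 2 + 2 * inner ℝ v vs + ‖vs‖ ^ 2 := norm_add_sq_real v vs
  have e3 : (inner ℝ (v + vs) σ : ℝ) = ‖v - vs‖ * inner ℝ u σ + 2 * inner ℝ vs σ := by
    have : v + vs = ‖v - vs‖ • u + (2:ℝ) • vs := by
      rw [← hwu]; module
    rw [this, inner_add_left, inner_smul_left, inner_smul_left]
    simp
  have en : ‖(2:ℝ)⁻¹ • (v + vs)‖ ^ 2 = ‖v + vs‖ ^ 2 / 4 := by
    rw [norm_smul, mul_pow]; norm_num; ring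
  have em : ‖((2:ℝ)⁻¹ * ‖v - vs‖) • σ‖ ^ 2 = ‖v - vs‖ ^ 2 / 4 := by
    rw [norm_smul, mul_pow, hσ]; simp; ring
  have ei : (inner ℝ ((2:ℝ)⁻¹ • (v + vs)) (((2:ℝ)⁻¹ * ‖v - vs‖) • σ) : ℝ)
      = ‖v - vs‖ * inner ℝ (v + vs) σ / 4 := by
    rw [inner_smul_left, inner_smul_right]; simp; ring
  have f1 : ‖postV v vs σ‖ ^ 2 = (1 + (inner ℝ u σ : ℝ)) / 2 * (‖v‖ ^ 2 + ‖vs‖ ^ 2)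
      - inner ℝ v vs * inner ℝ u σ + ‖v - vs‖ * inner ℝ vs σ := by
    rw [postV, norm_add_sq_real, en, em, ei, e3, e2]
    linear_combination (1 / 4 + (inner ℝ u σ : ℝ) / 2) * e1
  have f2 : ‖postVs v vs σ‖ ^ 2 = (1 - (1 + (inner ℝ u σ : ℝ)) / 2) * (‖v‖ ^ 2 + ‖vs‖ ^ 2)
      + inner ℝ v vs * inner ℝ u σ - ‖v - vs‖ * inner ℝ vs σ := by
    rw [postVs, norm_sub_sq_real, en, em, ei, e3, e2]
    linear_combination (1 / 4 - (inner ℝ u σ : ℝ) / 2) * e1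
  have b1 : |(inner ℝ v vs : ℝ) * inner ℝ u σ| ≤ ‖v‖ * ‖vs‖ := by
    rw [abs_mul]
    calc _ ≤ (‖v‖ * ‖vs‖) * 1 := by
          gcongr
          · exact abs_real_inner_le_norm v vs
          · exact abs_le.2 ⟨by linarith, by linarith⟩
      _ = _ := mul_one _
  have b2 : |‖v - vs‖ * (inner ℝ vs σ : ℝ)| ≤ (2 * ‖v‖) * ‖vs‖ := by
    rw [abs_mul, abs_norm]
    gcongr
    exact abs_le.2 ⟨by linarith [hvσ.1], by linarith [hvσ.2]⟩
  have b1' := abs_le.1 b1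
  have b2' := abs_le.1 b2
  have key := povz_real (p / 2) ‖v‖ ‖vs‖ ((1 + (inner ℝ u σ : ℝ)) / 2) ‖postV v vs σ‖
    ‖postVs v vs σ‖ (by linarith) hv (norm_nonneg _) hle ht ht1 (norm_nonneg _) (norm_nonneg _)
    (by linarith [b1'.1, b2'.2]) (by linarith [b1'.2, b2'.1]) δ hδ hδ1
  rw [show 2 * (p / 2) = p by ring] at key
  exact key
end
end

section
/- Let d ≥ 3. There is a constant C(d) < ∞ with the following property: for every Borel probability measure μ_0 on ℝ^d supported on the cube (−1,1]^d, if V_1, …, V_N are independent random variables with distribution μ_0 and μ_0^N = N^{−1}∑_{i=1}^N δ_{V_i} is the empirical distribution, then 𝔼( W_1(μ_0^N, μ_0) ) ≤ C(d) N^{−1/d}, where W_1(μ,ν) = sup { ∫ f dμ − ∫ f dν : f : ℝ^d → ℝ is 1-Lipschitz } is the Wasserstein-1 distance in its Kantorovich dual form. For d = 2 the same holds with N^{−1/d} replaced by N^{−1/2} log₂(N+1). -/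
open MeasureTheory ProbabilityTheory Filter
open scoped ENNReal NNReal RealInnerProductSpace

noncomputable section

open KacModel

/-- Wasserstein-1 distance in Kantorovich dual form. -/
noncomputable def W1dist {d : ℕ} (μ ν : MeasureTheory.Measure (Vd d)) : ℝ :=
  ⨆ f : {f : Vd d → ℝ // LipschitzWith 1 f},
    ((∫ v, f.1 v ∂μ) - ∫ v, f.1 v ∂ν)

/-- Cell index at level `k`. -/
def qIdx {d : ℕ} (k : ℕ) (v : Vd d) : Fin d → ℤ := fun i => ⌊(2:ℝ) ^ k * v i⌋

/-- Corner of a cell at level `k`. -/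
def cornerPt {d : ℕ} (k : ℕ) (c : Fin d → ℤ) : Vd d := WithLp.toLp 2 fun i => (c i : ℝ) / 2 ^ k

/-- Indices of the cells meeting the cube. -/
def cellIdx (d k : ℕ) : Finset (Fin d → ℤ) :=
  Fintype.piFinset fun _ => Finset.Icc (-(2:ℤ) ^ k) (2 ^ k)

/-- The cube. -/
def theCube (d : ℕ) : Set (Vd d) := {v | ∀ i, v i ∈ Set.Ioc (-1:ℝ) 1}

lemma measurable_qIdx {d : ℕ} (k : ℕ) : Measurable (qIdx (d := d) k) := by
  unfold qIdx
  refine measurable_pi_lambda _ fun i => ?_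
  refine Int.measurable_floor.comp ?_
  fun_prop

lemma qIdx_mem {d k : ℕ} {v : Vd d} (hv : v ∈ theCube d) : qIdx k v ∈ cellIdx d k := by
  simp only [cellIdx, Fintype.mem_piFinset, Finset.mem_Icc, qIdx]
  intro i
  obtain ⟨h1, h2⟩ := hv i
  have hp : (0:ℝ) < 2 ^ k := by positivity
  constructor
  · rw [Int.le_floor]; push_cast; nlinarith
  · rw [Int.floor_le_iff]; push_cast; nlinarith

lemma card_cellIdx (d k : ℕ) : ((cellIdx d k).card : ℝ) ≤ (3 * 2 ^ k) ^ d := by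
  have h : (cellIdx d k).card ≤ (3 * 2 ^ k) ^ d := by
    rw [cellIdx, Fintype.card_piFinset_const, Int.card_Icc]
    refine Nat.pow_le_pow_left ?_ d
    have : (1:ℤ) ≤ 2 ^ k := one_le_pow₀ (by norm_num)
    zify
    rw [Int.toNat_of_nonneg (by linarith)]
    linarith
  exact_mod_cast h

lemma norm_le_of_coord {d : ℕ} (x : Vd d) {r : ℝ} (hr : 0 ≤ r) (h : ∀ i, |x i| ≤ r) :
    ‖x‖ ≤ √d * r := by
  rw [EuclideanSpace.norm_eq]
  have : √d * r = √(∑ i : Fin d, r ^ 2) := by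
    simp [Real.sqrt_mul, Real.sqrt_sq hr]
  rw [this]
  apply Real.sqrt_le_sqrt
  refine Finset.sum_le_sum fun i _ => ?_
  rw [Real.norm_eq_abs]
  exact pow_le_pow_left₀ (abs_nonneg _) (h i) 2

lemma lip_sub {d : ℕ} {f : Vd d → ℝ} (hf : LipschitzWith 1 f) (x y : Vd d) {r : ℝ} (hr : 0 ≤ r)
    (h : ∀ i, |x i - y i| ≤ r) : |f x - f y| ≤ √d * r := by
  have h1 := hf.dist_le_mul x y
  rw [Real.dist_eq, NNReal.coe_one, one_mul, dist_eq_norm] at h1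
  exact h1.trans (norm_le_of_coord _ hr (by simpa using h))

lemma corner_close {d : ℕ} {f : Vd d → ℝ} (hf : LipschitzWith 1 f) (k : ℕ) (v : Vd d) :
    |f v - f (cornerPt k (qIdx k v))| ≤ √d * (2 ^ k)⁻¹ := by
  refine lip_sub hf _ _ (by positivity) fun i => ?_
  have hp : (0:ℝ) < 2 ^ k := by positivity
  have h1 := Int.floor_le ((2:ℝ) ^ k * v i)
  have h2 := Int.lt_floor_add_one ((2:ℝ) ^ k * v i)
  simp only [cornerPt, qIdx]
  have : v i - (⌊(2:ℝ) ^ k * v i⌋ : ℝ) / 2 ^ k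
    = (2 ^ k * v i - (⌊(2:ℝ) ^ k * v i⌋ : ℝ)) * (2 ^ k)⁻¹ := by field_simp
  rw [this, abs_mul, abs_of_pos (inv_pos.2 hp)]
  refine mul_le_of_le_one_left (by positivity) ?_
  rw [abs_le]; constructor <;> linarith

lemma qIdx_succ {d : ℕ} (k : ℕ) (v : Vd d) : qIdx k v = fun i => qIdx (k+1) v i / 2 := by
  funext i
  simp only [qIdx]
  have := Int.floor_div_natCast ((2:ℝ) ^ (k+1) * v i) 2
  push_cast at this
  rw [← this]
  congr 1
  rw [pow_succ]; ring

lemma corner_step {d : ℕ} {f : Vd d → ℝ} (hf : LipschitzWith 1 f) (k : ℕ) (c : Fin d → ℤ) :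
    |f (cornerPt (k+1) c) - f (cornerPt k fun i => c i / 2)| ≤ √d * (2 ^ (k+1))⁻¹ := by
  refine lip_sub hf _ _ (by positivity) fun i => ?_
  simp only [cornerPt]
  have hp : (0:ℝ) < 2 ^ (k+1) := by positivity
  have e : (c i : ℝ) = 2 * ((c i / 2 : ℤ) : ℝ) + ((c i % 2 : ℤ) : ℝ) := by
    exact_mod_cast (Int.mul_ediv_add_emod (c i) 2).symm
  have : (c i : ℝ) / 2 ^ (k+1) - ((c i / 2 : ℤ) : ℝ) / 2 ^ k
    = ((c i % 2 : ℤ) : ℝ) * (2 ^ (k+1))⁻¹ := by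
    rw [e]; rw [pow_succ]; field_simp; ring
  rw [this, abs_mul, abs_of_pos (inv_pos.2 hp)]
  refine mul_le_of_le_one_left (by positivity) ?_
  have h0 := Int.emod_nonneg (c i) (b := 2) (by norm_num)
  have h1 : c i % 2 ≤ 1 := by omega
  rw [abs_of_nonneg (by exact_mod_cast h0)]
  exact_mod_cast h1

lemma corner_zero {d : ℕ} {f : Vd d → ℝ} (hf : LipschitzWith 1 f) (c : Fin d → ℤ)
    (hc : c ∈ cellIdx d 0) : |f (cornerPt 0 c) - f 0| ≤ √d * (2 ^ 0)⁻¹ := by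
  refine lip_sub hf _ _ (by positivity) fun i => ?_
  simp only [cellIdx, Fintype.mem_piFinset, Finset.mem_Icc] at hc
  obtain ⟨h1, h2⟩ := hc i
  simp only [cornerPt]
  simp only [pow_zero, div_one, inv_one, PiLp.zero_apply, sub_zero] at *
  rw [abs_le]
  exact ⟨by exact_mod_cast h1, by exact_mod_cast h2⟩

lemma step_ae {d : ℕ} {μ : Measure (Vd d)} (hμ : ∀ᵐ v ∂μ, v ∈ theCube d) (k : ℕ)
    (h : (Fin d → ℤ) → ℝ) :
    (fun v => h (qIdx k v)) =ᵐ[μ]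
      fun v => ∑ c ∈ cellIdx d k, (qIdx k ⁻¹' {c}).indicator (fun _ => h c) v := by
  filter_upwards [hμ] with v hv
  rw [Finset.sum_eq_single (qIdx k v)]
  · simp
  · intro b _ hb
    simp [Set.indicator, Ne.symm hb]
  · intro hn; exact absurd (qIdx_mem hv) hn

lemma step_integrable {d : ℕ} {μ : Measure (Vd d)} [IsProbabilityMeasure μ]
    (hμ : ∀ᵐ v ∂μ, v ∈ theCube d) (k : ℕ)
    (h : (Fin d → ℤ) → ℝ) : Integrable (fun v => h (qIdx k v)) μ := by
  refine Integrable.congr ?_ (step_ae hμ k h).symm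
  refine integrable_finsetSum _ fun c _ => ?_
  exact (integrable_const _).indicator (measurable_qIdx k (measurableSet_singleton c))

lemma step_integral {d : ℕ} {μ : Measure (Vd d)} [IsProbabilityMeasure μ]
    (hμ : ∀ᵐ v ∂μ, v ∈ theCube d) (k : ℕ)
    (h : (Fin d → ℤ) → ℝ) :
    ∫ v, h (qIdx k v) ∂μ = ∑ c ∈ cellIdx d k, μ.real (qIdx k ⁻¹' {c}) * h c := by
  rw [integral_congr_ae (step_ae hμ k h), integral_finsetSum]
  · refine Finset.sum_congr rfl fun c _ => ?_
    rw [integral_indicator_const _ (measurable_qIdx k (measurableSet_singleton c)), smul_eq_mul]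
  · intro c _
    exact (integrable_const _).indicator (measurable_qIdx k (measurableSet_singleton c))

/-- Cell discrepancy at level `k`. -/
def cellDisc {d : ℕ} (μ ν : Measure (Vd d)) (k : ℕ) : ℝ :=
  ∑ c ∈ cellIdx d k, |μ.real (qIdx k ⁻¹' {c}) - ν.real (qIdx k ⁻¹' {c})|

lemma step_diff {d : ℕ} {μ ν : Measure (Vd d)} [IsProbabilityMeasure μ] [IsProbabilityMeasure ν]
    (hμ : ∀ᵐ v ∂μ, v ∈ theCube d) (hν : ∀ᵐ v ∂ν, v ∈ theCube d) (k : ℕ)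
    (h : (Fin d → ℤ) → ℝ) {M : ℝ} (hM : ∀ c ∈ cellIdx d k, |h c| ≤ M) :
    ∫ v, h (qIdx k v) ∂μ - ∫ v, h (qIdx k v) ∂ν ≤ M * cellDisc μ ν k := by
  rw [step_integral hμ, step_integral hν, ← Finset.sum_sub_distrib, cellDisc, Finset.mul_sum]
  refine Finset.sum_le_sum fun c hc => ?_
  rw [← sub_mul]
  refine (le_abs_self _).trans ?_
  rw [abs_mul, mul_comm]
  exact mul_le_mul_of_nonneg_right (hM c hc) (abs_nonneg _)

lemma chain_bound {d : ℕ} {μ ν : Measure (Vd d)} [IsProbabilityMeasure μ] [IsProbabilityMeasure ν]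
    (hμ : ∀ᵐ v ∂μ, v ∈ theCube d) (hν : ∀ᵐ v ∂ν, v ∈ theCube d)
    {f : Vd d → ℝ} (hf : LipschitzWith 1 f) (K : ℕ) :
    ∫ v, f (cornerPt K (qIdx K v)) ∂μ - ∫ v, f (cornerPt K (qIdx K v)) ∂ν ≤
      ∑ k ∈ Finset.range (K+1), √d * (2 ^ k)⁻¹ * cellDisc μ ν k := by
  induction K with
  | zero =>
    have := step_diff hμ hν 0 (fun c => f (cornerPt 0 c) - f 0) (fun c hc => corner_zero hf c hc)
    rw [integral_sub (step_integrable hμ 0 (fun c => f (cornerPt 0 c))) (integrable_const _),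
      integral_sub (step_integrable hν 0 (fun c => f (cornerPt 0 c))) (integrable_const _)] at this
    simp only [integral_const, probReal_univ, one_smul] at this
    simp only [zero_add, Finset.sum_range_one]
    linarith
  | succ K ih =>
    rw [Finset.sum_range_succ]
    have := step_diff hμ hν (K+1)
      (fun c => f (cornerPt (K+1) c) - f (cornerPt K fun i => c i / 2))
      (fun c _ => corner_step hf K c)
    simp only [← qIdx_succ] at this
    rw [integral_sub (step_integrable hμ (K+1) (fun c => f (cornerPt (K+1) c)))
        (step_integrable hμ K (fun c => f (cornerPt K c))),
      integral_sub (step_integrable hν (K+1) (fun c => f (cornerPt (K+1) c)))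
        (step_integrable hν K (fun c => f (cornerPt K c)))] at this
    linarith

lemma lip_close {d : ℕ} {μ : Measure (Vd d)} [IsProbabilityMeasure μ]
    (hμ : ∀ᵐ v ∂μ, v ∈ theCube d)
    {f : Vd d → ℝ} (hf : LipschitzWith 1 f) (K : ℕ) :
    |∫ v, f v ∂μ - ∫ v, f (cornerPt K (qIdx K v)) ∂μ| ≤ √d * (2 ^ K)⁻¹ := by
  have hs := step_integrable hμ K (fun c => f (cornerPt K c))
  have hd : Integrable (fun v => f v - f (cornerPt K (qIdx K v))) μ := by
    refine Integrable.of_bound (hf.continuous.aestronglyMeasurable.sub hs.1) (√d * (2 ^ K)⁻¹) ?_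
    exact ae_of_all _ fun v => corner_close hf K v
  have hfi : Integrable f μ := by
    refine (hd.add hs).congr (ae_of_all _ fun v => ?_)
    simp
  rw [← integral_sub hfi hs, ← Real.norm_eq_abs]
  have := norm_integral_le_of_norm_le_const (μ := μ)
    (f := fun v => f v - f (cornerPt K (qIdx K v))) (C := √d * (2 ^ K)⁻¹) (ae_of_all _ fun v => corner_close hf K v)
  simpa using this

lemma W1_bound {d : ℕ} {μ ν : Measure (Vd d)} [IsProbabilityMeasure μ] [IsProbabilityMeasure ν]
    (hμ : ∀ᵐ v ∂μ, v ∈ theCube d) (hν : ∀ᵐ v ∂ν, v ∈ theCube d) (K : ℕ) :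
    W1dist μ ν ≤ 2 * √d * (2 ^ K)⁻¹ +
      ∑ k ∈ Finset.range (K+1), √d * (2 ^ k)⁻¹ * cellDisc μ ν k := by
  have : Nonempty {f : Vd d → ℝ // LipschitzWith 1 f} := ⟨⟨fun _ => 0, LipschitzWith.const' 0⟩⟩
  refine ciSup_le fun ⟨f, hf⟩ => ?_
  have h1 := abs_le.1 (lip_close hμ hf K)
  have h2 := abs_le.1 (lip_close hν hf K)
  have h3 := chain_bound hμ hν hf K
  simp only
  linarith [h1.2, h2.1]

lemma emp_real {d N : ℕ} {Ω : Type} (Vs : Fin N → Ω → Vd d) (ω : Ω)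
    {A : Set (Vd d)} (hA : MeasurableSet A) :
    (empMeasure Vs ω).real A = (N:ℝ)⁻¹ * ∑ i, A.indicator (fun _ => (1:ℝ)) (Vs i ω) := by
  rw [empMeasure, measureReal_ennreal_smul_apply, measureReal_def, Measure.finsetSum_apply,
    ENNReal.toReal_sum]
  · simp only [ENNReal.toReal_inv, ENNReal.toReal_natCast]
    congr 1
    refine Finset.sum_congr rfl fun i _ => ?_
    rw [Measure.dirac_apply' _ hA]
    by_cases h : Vs i ω ∈ A <;> simp [h]
  · intro i _; exact measure_ne_top _ _

lemma emp_prob {d N : ℕ} (hN : N ≠ 0) {Ω : Type} (Vs : Fin N → Ω → Vd d) (ω : Ω) :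
    IsProbabilityMeasure (empMeasure Vs ω) := by
  constructor
  rw [empMeasure, Measure.smul_apply, Measure.finsetSum_apply]
  simp only [measure_univ, Finset.sum_const, Finset.card_univ, Fintype.card_fin, nsmul_eq_mul,
    mul_one, smul_eq_mul]
  exact ENNReal.inv_mul_cancel (by exact_mod_cast hN) (by simp)

lemma measurableSet_cube (d : ℕ) : MeasurableSet (theCube d) := by
  have : theCube d = ⋂ i, (fun v : Vd d => v i) ⁻¹' Set.Ioc (-1:ℝ) 1 := by
    ext v; simp [theCube]
  rw [this]
  exact MeasurableSet.iInter fun i => (by fun_prop : Measurable fun v : Vd d => v i) measurableSet_Ioc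

lemma emp_cube {d N : ℕ} {Ω : Type} (Vs : Fin N → Ω → Vd d) (ω : Ω)
    (h : ∀ i, Vs i ω ∈ theCube d) : ∀ᵐ v ∂(empMeasure Vs ω), v ∈ theCube d := by
  rw [ae_iff, empMeasure, Measure.smul_apply, Measure.finsetSum_apply, Finset.sum_eq_zero, smul_zero]
  intro i _
  rw [← ae_iff]
  exact (ae_dirac_iff (measurableSet_cube d)).2 (h i)

lemma cell_var {d N : ℕ} (hN : N ≠ 0) {μ0 : Measure (Vd d)} [IsProbabilityMeasure μ0] {Ω : Type}
    {m : MeasurableSpace Ω} {P : Measure Ω} [IsProbabilityMeasure P] {Vs : Fin N → Ω → Vd d}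
    (hm : ∀ i, Measurable (Vs i)) (hi : iIndepFun Vs P) (hl : ∀ i, P.map (Vs i) = μ0)
    {A : Set (Vd d)} (hA : MeasurableSet A) :
    MemLp (fun ω => (empMeasure Vs ω).real A - μ0.real A) 2 P ∧
    ∫ ω, ((empMeasure Vs ω).real A - μ0.real A) ^ 2 ∂P ≤ μ0.real A / N := by
  set X : Fin N → Ω → ℝ := fun i ω => A.indicator (fun _ => (1:ℝ)) (Vs i ω) with hX
  have hgm : Measurable (A.indicator (fun _ => (1:ℝ))) := measurable_const.indicator hA
  have hXm : ∀ i, Measurable (X i) := fun i => hgm.comp (hm i)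
  have hXL : ∀ i, MemLp (X i) 2 P := fun i =>
    MemLp.of_bound (hXm i).aestronglyMeasurable 1 (ae_of_all _ fun ω => by
      simp only [hX]; by_cases h : Vs i ω ∈ A <;> simp [h])
  have hXE : ∀ i, ∫ ω, X i ω ∂P = μ0.real A := fun i => by
    have := integral_map (μ := P) (hm i).aemeasurable (f := A.indicator (fun _ => (1:ℝ)))
      hgm.aestronglyMeasurable
    rw [hl i, integral_indicator_const _ hA] at this
    simpa using this.symm
  have hXsq : ∀ i, (X i) ^ 2 = X i := fun i => by
    funext ω
    simp only [hX, Pi.pow_apply]; by_cases h : Vs i ω ∈ A <;> simp [h]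
  have hvar : ∀ i, variance (X i) P ≤ μ0.real A := fun i => by
    have := variance_le_expectation_sq (μ := P) (X := X i) (hXm i).aestronglyMeasurable
    rw [hXsq i, hXE i] at this
    exact this
  have hind : Set.Pairwise ↑(Finset.univ : Finset (Fin N)) fun i j => IndepFun (X i) (X j) P := by
    intro i _ j _ hij
    exact (hi.indepFun hij).comp hgm hgm
  have hsum := IndepFun.variance_sum (μ := P) (fun i (_ : i ∈ Finset.univ) => hXL i) hind
  have hN' : (0:ℝ) < N := by exact_mod_cast Nat.pos_of_ne_zero hN
  set Y : Ω → ℝ := fun ω => (N:ℝ)⁻¹ * (∑ i, X i) ω with hY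
  have hYL : MemLp Y 2 P := (memLp_finsetSum' Finset.univ fun i _ => hXL i).const_mul _
  have hYe : ∀ ω, (empMeasure Vs ω).real A = Y ω := fun ω => by
    rw [emp_real Vs ω hA, hY]; simp [hX]
  have hYE : ∫ ω, Y ω ∂P = μ0.real A := by
    simp only [hY, Finset.sum_apply]
    rw [integral_const_mul, integral_finsetSum _ fun i _ => (hXL i).integrable one_le_two]
    simp only [hXE]
    simp
    field_simp
  have hYV : variance Y P ≤ μ0.real A / N := by
    rw [hY, variance_const_mul, hsum]
    calc ((N:ℝ)⁻¹) ^ 2 * ∑ i, variance (X i) P ≤ ((N:ℝ)⁻¹) ^ 2 * ∑ i : Fin N, μ0.real A := by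
          gcongr with i; exact hvar i
      _ = μ0.real A / N := by simp; field_simp
  simp only [hYe]
  refine ⟨hYL.sub (memLp_const _), ?_⟩
  rw [variance_eq_integral hYL.aestronglyMeasurable.aemeasurable, hYE] at hYV
  exact hYV

lemma disc_exp {d N : ℕ} (hN : N ≠ 0) {μ0 : Measure (Vd d)} [IsProbabilityMeasure μ0] {Ω : Type}
    {m : MeasurableSpace Ω} {P : Measure Ω} [IsProbabilityMeasure P] {Vs : Fin N → Ω → Vd d}
    (hm : ∀ i, Measurable (Vs i)) (hi : iIndepFun Vs P) (hl : ∀ i, P.map (Vs i) = μ0) (k : ℕ) :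
    Integrable (fun ω => cellDisc (empMeasure Vs ω) μ0 k) P ∧
    ∫ ω, cellDisc (empMeasure Vs ω) μ0 k ∂P ≤ √((3 * 2 ^ k) ^ d / N) := by
  have hms : ∀ c : Fin d → ℤ, MeasurableSet (qIdx k ⁻¹' {c}) := fun c =>
    measurable_qIdx k (measurableSet_singleton c)
  have hc := fun c => cell_var hN hm hi hl (hms c)
  have hL : MemLp (fun ω => cellDisc (empMeasure Vs ω) μ0 k) 2 P :=
    memLp_finsetSum _ fun c _ => (hc c).1.abs
  refine ⟨hL.integrable one_le_two, ?_⟩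
  have hN' : (0:ℝ) < N := by exact_mod_cast Nat.pos_of_ne_zero hN
  apply Real.le_sqrt_of_sq_le
  have h1 : (∫ ω, cellDisc (empMeasure Vs ω) μ0 k ∂P) ^ 2 ≤
      ∫ ω, (cellDisc (empMeasure Vs ω) μ0 k) ^ 2 ∂P := by
    have := variance_nonneg (fun ω => cellDisc (empMeasure Vs ω) μ0 k) P
    rw [variance_eq_sub hL] at this
    simp only [Pi.pow_apply] at this
    linarith
  have hsqi : ∀ c, Integrable (fun ω => ((empMeasure Vs ω).real (qIdx k ⁻¹' {c})
      - μ0.real (qIdx k ⁻¹' {c})) ^ 2) P := fun c => (hc c).1.integrable_sq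
  have h2 : ∫ ω, (cellDisc (empMeasure Vs ω) μ0 k) ^ 2 ∂P ≤
      ∫ ω, ((cellIdx d k).card : ℝ) * ∑ c ∈ cellIdx d k, ((empMeasure Vs ω).real (qIdx k ⁻¹' {c})
      - μ0.real (qIdx k ⁻¹' {c})) ^ 2 ∂P := by
    refine integral_mono hL.integrable_sq
      ((integrable_finsetSum _ fun c _ => hsqi c).const_mul _) fun ω => ?_
    have := sq_sum_le_card_mul_sum_sq (s := cellIdx d k)
      (f := fun c => |(empMeasure Vs ω).real (qIdx k ⁻¹' {c}) - μ0.real (qIdx k ⁻¹' {c})|)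
    simp only [sq_abs] at this
    exact this
  have h3 : ∑ c ∈ cellIdx d k, μ0.real (qIdx k ⁻¹' {c}) ≤ 1 := by
    rw [← measureReal_biUnion_finset]
    · exact measureReal_le_one
    · intro a _ b _ hab
      exact Disjoint.preimage _ (by simpa using hab)
    · intro c _; exact hms c
  refine h1.trans (h2.trans ?_)
  rw [integral_const_mul, integral_finsetSum _ fun c _ => hsqi c]
  calc _ ≤ ((cellIdx d k).card : ℝ) * ∑ c ∈ cellIdx d k, μ0.real (qIdx k ⁻¹' {c}) / N := by
        gcongr with c _; exact (hc c).2
    _ = ((cellIdx d k).card : ℝ) * (∑ c ∈ cellIdx d k, μ0.real (qIdx k ⁻¹' {c})) / N := by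
        rw [← Finset.sum_div, mul_div_assoc]
    _ ≤ (3 * 2 ^ k) ^ d * 1 / N := by
        gcongr
        exact card_cellIdx d k
    _ = _ := by rw [mul_one]

lemma W1_exp {d N : ℕ} (hN : N ≠ 0) {μ0 : Measure (Vd d)} [IsProbabilityMeasure μ0] {Ω : Type}
    {m : MeasurableSpace Ω} {P : Measure Ω} [IsProbabilityMeasure P] {Vs : Fin N → Ω → Vd d}
    (h0 : μ0 {v : Vd d | ¬ ∀ i, v i ∈ Set.Ioc (-1:ℝ) 1} = 0)
    (hm : ∀ i, Measurable (Vs i)) (hi : iIndepFun Vs P) (hl : ∀ i, P.map (Vs i) = μ0) (K : ℕ) :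
    ∫⁻ ω, ENNReal.ofReal (W1dist (empMeasure Vs ω) μ0) ∂P ≤
      ENNReal.ofReal (2 * √d * (2 ^ K)⁻¹ +
        ∑ k ∈ Finset.range (K+1), √d * (2 ^ k)⁻¹ * √((3 * 2 ^ k) ^ d / N)) := by
  have hμ : ∀ᵐ v ∂μ0, v ∈ theCube d := h0
  have hV : ∀ᵐ ω ∂P, ∀ i, Vs i ω ∈ theCube d := by
    rw [ae_all_iff]
    intro i
    have : ∀ᵐ v ∂(P.map (Vs i)), v ∈ theCube d := by rw [hl i]; exact hμ
    exact ae_of_ae_map (hm i).aemeasurable this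
  have hint : ∀ k, Integrable (fun ω => √d * (2 ^ k)⁻¹ * cellDisc (empMeasure Vs ω) μ0 k) P :=
    fun k => (disc_exp hN hm hi hl k).1.const_mul _
  have hG : Integrable (fun ω => 2 * √d * (2 ^ K)⁻¹ +
      ∑ k ∈ Finset.range (K+1), √d * (2 ^ k)⁻¹ * cellDisc (empMeasure Vs ω) μ0 k) P :=
    (integrable_const _).add (integrable_finsetSum _ fun k _ => hint k)
  have hdn : ∀ k ω, 0 ≤ cellDisc (empMeasure Vs ω) μ0 k := fun k ω =>
    Finset.sum_nonneg fun c _ => abs_nonneg _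
  calc _ ≤ ∫⁻ ω, ENNReal.ofReal (2 * √d * (2 ^ K)⁻¹ +
      ∑ k ∈ Finset.range (K+1), √d * (2 ^ k)⁻¹ * cellDisc (empMeasure Vs ω) μ0 k) ∂P := by
        refine lintegral_mono_ae ?_
        filter_upwards [hV] with ω hω
        have := emp_prob hN Vs ω
        exact ENNReal.ofReal_le_ofReal (W1_bound (emp_cube Vs ω hω) hμ K)
    _ = ENNReal.ofReal (∫ ω, (2 * √d * (2 ^ K)⁻¹ +
      ∑ k ∈ Finset.range (K+1), √d * (2 ^ k)⁻¹ * cellDisc (empMeasure Vs ω) μ0 k) ∂P) := by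
        rw [ofReal_integral_eq_lintegral_ofReal hG]
        refine ae_of_all _ fun ω => ?_
        have : 0 ≤ ∑ k ∈ Finset.range (K+1), √d * (2 ^ k)⁻¹ * cellDisc (empMeasure Vs ω) μ0 k :=
          Finset.sum_nonneg fun k _ => mul_nonneg (by positivity) (hdn k ω)
        simp only [Pi.zero_apply]
        positivity
    _ ≤ _ := by
        apply ENNReal.ofReal_le_ofReal
        rw [integral_add (integrable_const _) (integrable_finsetSum _ fun k _ => hint k),
          integral_finsetSum _ fun k _ => hint k]
        simp only [integral_const, probReal_univ, one_smul, integral_const_mul]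
        gcongr with k _
        exact (disc_exp hN hm hi hl k).2

lemma W1_zero {d : ℕ} {μ0 : Measure (Vd d)} [IsProbabilityMeasure μ0] : W1dist 0 μ0 = 0 := by
  unfold W1dist
  apply Real.iSup_of_not_bddAbove
  rintro ⟨M, hM⟩
  have := hM ⟨⟨fun _ => -(M+1), LipschitzWith.const' _⟩, rfl⟩
  simp at this
  linarith

lemma term_eq {d N : ℕ} (k : ℕ) :
    √d * (2 ^ k)⁻¹ * √((3 * 2 ^ k) ^ d / N) = √d * √(3 ^ d) / √N * (√(2 ^ d) / 2) ^ k := by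
  have : ((3:ℝ) * 2 ^ k) ^ d = 3 ^ d * (2 ^ d) ^ k := by
    rw [mul_pow, ← pow_mul, ← pow_mul, mul_comm k d]
  rw [this, Real.sqrt_div (by positivity), Real.sqrt_mul (by positivity), div_pow]
  have h2 : √(((2:ℝ) ^ d) ^ k) = √(2 ^ d) ^ k := by
    rw [Real.sqrt_eq_iff_eq_sq (by positivity) (by positivity), pow_right_comm (√(2 ^ d)),
      Real.sq_sqrt (by positivity)]
  rw [h2]
  field_simp

lemma rate3 {d : ℕ} (hd : 3 ≤ d) : ∃ C : ℝ, 0 ≤ C ∧ ∀ N : ℕ, N ≠ 0 → ∃ K : ℕ,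
    2 * √d * (2 ^ K)⁻¹ +
        ∑ k ∈ Finset.range (K+1), √d * (2 ^ k)⁻¹ * √((3 * 2 ^ k) ^ d / N) ≤
      C * (N : ℝ) ^ (-(1:ℝ)/d) := by
  set r : ℝ := √(2 ^ d) / 2 with hr
  have hr1 : 1 < r := by
    rw [hr, lt_div_iff₀ (by norm_num), one_mul]
    apply Real.lt_sqrt_of_sq_lt
    calc (2:ℝ) ^ 2 < 2 ^ 3 := by norm_num
      _ ≤ 2 ^ d := pow_le_pow_right₀ (by norm_num) hd
  have hr0 : 0 < r - 1 := by linarith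
  set B : ℝ := 2 * √d + √d * √(3 ^ d) * (r / (r - 1)) with hB
  have hB0 : 0 ≤ B := by
    have : 0 ≤ r / (r-1) := by apply div_nonneg <;> linarith
    positivity
  refine ⟨B * 2, by positivity, fun N hN => ?_⟩
  have hN' : (0:ℝ) < N := by exact_mod_cast Nat.pos_of_ne_zero hN
  refine ⟨Nat.log (2 ^ d) N, ?_⟩
  set K := Nat.log (2 ^ d) N with hK
  have k1 : ((2:ℝ) ^ d) ^ K ≤ N := by exact_mod_cast Nat.pow_log_le_self (2 ^ d) hN
  have k2 : (N:ℝ) < (2 ^ d) ^ (K+1) := by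
    exact_mod_cast Nat.lt_pow_succ_log_self (Nat.one_lt_two_pow (by omega)) N
  have e1 : r ^ K ≤ √N * (2 ^ K)⁻¹ := by
    rw [hr, div_pow, div_eq_mul_inv]
    gcongr
    apply Real.le_sqrt_of_sq_le
    rwa [← pow_mul, mul_comm K 2, pow_mul, Real.sq_sqrt (by positivity)]
  have e2 : ((2:ℝ) ^ K)⁻¹ ≤ 2 * (N : ℝ) ^ (-(1:ℝ)/d) := by
    have hd0 : (d:ℝ) ≠ 0 := by positivity
    have : (N:ℝ) ^ ((1:ℝ)/d) ≤ 2 ^ (K+1) := by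
      calc (N:ℝ) ^ ((1:ℝ)/d) ≤ ((2 ^ d) ^ (K+1) : ℝ) ^ ((1:ℝ)/d) := by
            gcongr
        _ = 2 ^ (K+1) := by
            rw [← pow_mul, mul_comm, pow_mul, one_div, Real.pow_rpow_inv_natCast (by positivity)
              (by omega)]
    rw [neg_div, Real.rpow_neg hN'.le]
    rw [pow_succ] at this
    have hp : 0 < (N:ℝ) ^ ((1:ℝ)/d) := by positivity
    rw [← div_eq_mul_inv, inv_le_comm₀ (by positivity) (by positivity), inv_div]
    linarith
  have e3 : ∑ k ∈ Finset.range (K+1), r ^ k ≤ r / (r-1) * r ^ K := by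
    rw [geom_sum_eq hr1.ne', div_mul_eq_mul_div]
    gcongr
    rw [pow_succ]; linarith
  simp only [term_eq, ← Finset.mul_sum]
  rw [← hr]
  calc _ ≤ 2 * √d * (2 ^ K)⁻¹ + √d * √(3 ^ d) / √N * (r / (r-1) * (√N * (2 ^ K)⁻¹)) := by
        have : 0 ≤ r / (r-1) := by apply div_nonneg <;> linarith
        gcongr
        exact e3.trans (by gcongr)
    _ = B * (2 ^ K)⁻¹ := by
        have : √(N:ℝ) ≠ 0 := by positivity
        rw [hB]; field_simp
    _ ≤ B * (2 * (N : ℝ) ^ (-(1:ℝ)/d)) := by gcongr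
    _ = _ := by ring

lemma rate2 : ∃ C : ℝ, 0 ≤ C ∧ ∀ N : ℕ, N ≠ 0 → ∃ K : ℕ,
    2 * √(2:ℕ) * (2 ^ K)⁻¹ +
        ∑ k ∈ Finset.range (K+1), √(2:ℕ) * (2 ^ k)⁻¹ * √((3 * 2 ^ k) ^ 2 / N) ≤
      C * ((N : ℝ) ^ (-(1:ℝ)/2) * Real.logb 2 (N + 1)) := by
  refine ⟨10 * √(2:ℕ), by positivity, fun N hN => ?_⟩
  have hN1 : (1:ℝ) ≤ N := by exact_mod_cast Nat.one_le_iff_ne_zero.2 hN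
  have hN' : (0:ℝ) < N := by linarith
  refine ⟨Nat.log (2 ^ 2) N, ?_⟩
  set K := Nat.log (2 ^ 2) N with hK
  have k1 : ((2:ℝ) ^ 2) ^ K ≤ N := by exact_mod_cast Nat.pow_log_le_self (2 ^ 2) hN
  have k2 : (N:ℝ) < (2 ^ 2) ^ (K+1) := by
    exact_mod_cast Nat.lt_pow_succ_log_self (by norm_num) N
  set L := Real.logb 2 (N + 1) with hL
  have hL1 : 1 ≤ L := by
    rw [hL, Real.le_logb_iff_rpow_le (by norm_num) (by positivity), Real.rpow_one]; linarith
  have hLK : (K:ℝ) ≤ L := by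
    rw [hL, Real.le_logb_iff_rpow_le (by norm_num) (by positivity), Real.rpow_natCast]
    have : (2:ℝ) ^ K ≤ (2 ^ 2) ^ K := by gcongr; norm_num
    linarith
  have hs : (N : ℝ) ^ (-(1:ℝ)/2) = (√N)⁻¹ := by
    rw [neg_div, Real.rpow_neg hN'.le, Real.sqrt_eq_rpow]
  have e2 : ((2:ℝ) ^ K)⁻¹ ≤ 2 * (√N)⁻¹ := by
    have : √(N:ℝ) ≤ 2 ^ (K+1) := by
      apply Real.sqrt_le_iff.2 ⟨by positivity, ?_⟩
      rw [← pow_mul, mul_comm, pow_mul]; exact k2.le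
    rw [pow_succ] at this
    have hp : 0 < √(N:ℝ) := by positivity
    rw [← div_eq_mul_inv, inv_le_comm₀ (by positivity) (by positivity), inv_div]
    linarith
  have hr : √((2:ℝ) ^ 2) / 2 = 1 := by rw [Real.sqrt_sq (by norm_num)]; norm_num
  have h3 : √((3:ℝ) ^ 2) = 3 := Real.sqrt_sq (by norm_num)
  have := fun k => term_eq (d := 2) (N := N) k
  simp only [this, hr, h3, one_pow, mul_one, Finset.sum_const, Finset.card_range, nsmul_eq_mul, hs]
  push_cast
  set s := (√(N:ℝ))⁻¹
  have hs0 : 0 ≤ s := by positivity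
  have a1 : s ≤ s * L := le_mul_of_one_le_right hs0 hL1
  have a2 : s * K ≤ s * L := by gcongr
  rw [div_eq_mul_inv]
  calc _ ≤ 2 * √2 * (2 * s) + (K + 1) * (√2 * 3 * s) := by gcongr
    _ = √2 * (4 * s + 3 * (s * K) + 3 * s) := by ring
    _ ≤ √2 * (10 * (s * L)) := by
        apply mul_le_mul_of_nonneg_left _ (by positivity); linarith
    _ = _ := by ring

/-- The rate of convergence of empirical measures of a compactly supported law
in Wasserstein-1 distance (estimate (8.1)). -/
theorem empirical_W1_rate_on_cube (d : ℕ) (hd : 2 ≤ d) :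
    ∃ C : ℝ, 0 ≤ C ∧
      ∀ μ0 : Measure (Vd d), IsProbabilityMeasure μ0 →
        μ0 {v : Vd d | ¬ ∀ i, v i ∈ Set.Ioc (-1:ℝ) 1} = 0 →
      ∀ (Ω : Type) (m : MeasurableSpace Ω) (P : Measure Ω),
        IsProbabilityMeasure P →
      ∀ (N : ℕ) (Vs : Fin N → Ω → Vd d),
        (∀ i, Measurable (Vs i)) →
        iIndepFun Vs P →
        (∀ i, P.map (Vs i) = μ0) →
        (3 ≤ d →
          ∫⁻ ω, ENNReal.ofReal (W1dist (empMeasure Vs ω) μ0) ∂P ≤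
            ENNReal.ofReal (C * (N : ℝ) ^ (-(1:ℝ)/d))) ∧
        (d = 2 →
          ∫⁻ ω, ENNReal.ofReal (W1dist (empMeasure Vs ω) μ0) ∂P ≤
            ENNReal.ofReal (C * ((N : ℝ) ^ (-(1:ℝ)/2) * Real.logb 2 (N + 1)))) := by
  obtain ⟨C, hC0, hC3, hC2⟩ : ∃ C : ℝ, 0 ≤ C ∧
      (3 ≤ d → ∀ N : ℕ, N ≠ 0 → ∃ K : ℕ, 2 * √d * (2 ^ K)⁻¹ +
        ∑ k ∈ Finset.range (K+1), √d * (2 ^ k)⁻¹ * √((3 * 2 ^ k) ^ d / N) ≤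
          C * (N : ℝ) ^ (-(1:ℝ)/d)) ∧
      (d = 2 → ∀ N : ℕ, N ≠ 0 → ∃ K : ℕ, 2 * √d * (2 ^ K)⁻¹ +
        ∑ k ∈ Finset.range (K+1), √d * (2 ^ k)⁻¹ * √((3 * 2 ^ k) ^ d / N) ≤
          C * ((N : ℝ) ^ (-(1:ℝ)/2) * Real.logb 2 (N + 1))) := by
    rcases Nat.lt_or_ge 2 d with h | h
    · obtain ⟨C, h1, h2⟩ := rate3 (d := d) h
      exact ⟨C, h1, fun _ => h2, fun h' => by omega⟩
    · obtain rfl : d = 2 := le_antisymm h hd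
      obtain ⟨C, h1, h2⟩ := rate2
      exact ⟨C, h1, fun h' => by omega, fun _ => h2⟩
  refine ⟨C, hC0, ?_⟩
  intro μ0 hμ0 h0 Ω m P hP N Vs hm hi hl
  rcases eq_or_ne N 0 with rfl | hN
  · have : ∀ ω, W1dist (empMeasure Vs ω) μ0 = 0 := fun ω => by
      have : empMeasure Vs ω = 0 := by simp [empMeasure]
      rw [this, W1_zero]
    simp [this]
  · constructor
    · intro h
      obtain ⟨K, hK⟩ := hC3 h N hN
      exact (W1_exp hN h0 hm hi hl K).trans (ENNReal.ofReal_le_ofReal hK)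
    · intro h
      obtain ⟨K, hK⟩ := hC2 h N hN
      exact (W1_exp hN h0 hm hi hl K).trans (ENNReal.ofReal_le_ofReal hK)
end
end

section
/- Let d ≥ 2, p ∈ (2,∞) and q ∈ (d+p, ∞). Let c > 0 and r > 0 be such that the measure μ(dv) = c · 1_{{|v| > r}} |v|^{−q} dv belongs to the Boltzmann sphere 𝒮 (such c, r exist since q > d + 2). Then ∫|v|^p μ(dv) < ∞, and there is a constant c′ > 0 such that, for all N ∈ ℕ, if μ^N is the N-sample empirical distribution of independent random variables with distribution μ, then 𝔼( W(μ^N, μ) ) ≥ c′ N^{−1 + (d+2)/q}. In particular, for p ∈ (2, 3d/(d−1)), letting q ↓ p + d shows that the exponent β(p) = (p−2)/(p+d) in the sample-empirical approximation rate cannot be improved. -/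
open MeasureTheory ProbabilityTheory Filter
open scoped ENNReal NNReal RealInnerProductSpace

noncomputable section

open KacModel

lemma testF_abs_le {d : ℕ} {f : Vd d → ℝ} (hf : f ∈ testF d) (v : Vd d) :
    ‖f v‖ ≤ 1 + ‖v‖ ^ 2 := by
  have h := hf.1 v
  have h0 : (0:ℝ) < 1 + ‖v‖ ^ 2 := by positivity
  rw [abs_div, abs_of_pos h0, div_le_one h0] at h
  simpa using h

lemma W_lower {d : ℕ} (μ : Measure (Vd d)) [IsProbabilityMeasure μ]
    (hint : Integrable (fun v : Vd d => ‖v‖ ^ 2) μ) {N : ℕ} (hN : 0 < N) (x : Fin N → Vd d) :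
    ∫⁻ v, Set.indicator {v : Vd d | ∀ i, 1 ≤ dist v (x i)}
      (fun v => ENNReal.ofReal (1 + ‖v‖ ^ 2)) v ∂μ ≤
    ENNReal.ofReal (Wdist ((N : ℝ≥0∞)⁻¹ • ∑ i, Measure.dirac (x i)) μ) := by
  have hg : Integrable (fun v : Vd d => 1 + ‖v‖ ^ 2) μ := (integrable_const _).add hint
  set ν : Measure (Vd d) := (N : ℝ≥0∞)⁻¹ • ∑ i, Measure.dirac (x i) with hν
  have hNi : (N : ℝ≥0∞)⁻¹ ≠ ⊤ := by
    simp [hN.ne']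
  have hd : ∀ (g : Vd d → ℝ), Integrable g (∑ i, Measure.dirac (x i)) := by
    intro g
    refine integrable_finsetSum_measure.2 fun i _ => ?_
    exact integrable_dirac (by simp)
  have hgν : Integrable (fun v : Vd d => 1 + ‖v‖ ^ 2) ν := (hd _).smul_measure hNi
  let S : Set (Vd d) := Set.range x
  have hSne : S.Nonempty := ⟨x ⟨0, hN⟩, ⟨_, rfl⟩⟩
  let h : Vd d → ℝ := fun v => min 1 (Metric.infDist v S)
  have h0 : ∀ v, 0 ≤ h v := fun v => le_min zero_le_one Metric.infDist_nonneg
  have h1 : ∀ v, h v ≤ 1 := fun v => min_le_left _ _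
  have hlip : ∀ v w, |h v - h w| ≤ ‖v - w‖ := by
    intro v w
    have e := (Metric.lipschitz_infDist_pt S).dist_le_mul v w
    rw [Real.dist_eq, dist_eq_norm] at e
    refine le_trans ?_ (by simpa using e)
    have := abs_min_sub_min_le_max 1 (Metric.infDist v S) 1 (Metric.infDist w S)
    simpa using this
  have hcont : Continuous h := continuous_const.min (Metric.continuous_infDist_pt S)
  let f : Vd d → ℝ := fun v => -((1 + ‖v‖ ^ 2) * h v)
  have hfdiv : ∀ v, f v / (1 + ‖v‖ ^ 2) = - h v := by
    intro v
    have : (1 + ‖v‖ ^ 2 : ℝ) ≠ 0 := by positivity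
    simp only [f]; field_simp
  have hf : f ∈ testF d := by
    constructor
    · intro v; rw [hfdiv, abs_neg, abs_of_nonneg (h0 v)]; exact h1 v
    · intro v w; rw [hfdiv, hfdiv]
      have := hlip w v
      rw [norm_sub_rev] at this
      convert this using 2; ring
  have hbdd : BddAbove (Set.range fun f : testF d =>
      ((∫ v, (f : Vd d → ℝ) v ∂ν) - ∫ v, (f : Vd d → ℝ) v ∂μ)) := by
    refine ⟨(∫ v, (1 + ‖v‖ ^ 2) ∂ν) + ∫ v, (1 + ‖v‖ ^ 2) ∂μ, ?_⟩
    rintro _ ⟨g, rfl⟩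
    have a := norm_integral_le_of_norm_le hgν (ae_of_all _ (testF_abs_le g.2))
    have b := norm_integral_le_of_norm_le hg (ae_of_all _ (testF_abs_le g.2))
    rw [Real.norm_eq_abs] at a b
    have := (abs_le.1 a).2
    have := (abs_le.1 b).1
    simp only
    linarith
  have hW : (∫ v, f v ∂ν) - ∫ v, f v ∂μ ≤ Wdist ν μ := le_ciSup hbdd ⟨f, hf⟩
  have hfν : ∫ v, f v ∂ν = 0 := by
    rw [hν, integral_smul_measure, integral_finsetSum_measure
      (fun i _ => integrable_dirac (by simp))]
    have : ∀ i, f (x i) = 0 := by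
      intro i
      have : Metric.infDist (x i) S = 0 := Metric.infDist_zero_of_mem ⟨i, rfl⟩
      simp [f, h, this]
    simp [integral_dirac, this]
  rw [hfν, zero_sub, ← integral_neg] at hW
  have hfi : Integrable (fun v => -f v) μ := by
    refine hg.mono' ?_ (ae_of_all _ fun v => by rw [norm_neg]; exact testF_abs_le hf v)
    have : Continuous (fun v => -f v) := by
      simp only [f]; fun_prop
    exact this.aestronglyMeasurable
  refine le_trans ?_ (ENNReal.ofReal_le_ofReal hW)
  rw [ofReal_integral_eq_lintegral_ofReal hfi
    (ae_of_all _ fun v => by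
      simp only [f, neg_neg, Pi.zero_apply]; have := h0 v; positivity)]
  refine lintegral_mono fun v => ?_
  refine Set.indicator_apply_le' (fun hv => ?_) (fun _ => by simp)
  refine ENNReal.ofReal_le_ofReal ?_
  have : h v = 1 := by
    refine min_eq_left ?_
    rw [Metric.le_infDist hSne]
    rintro _ ⟨i, rfl⟩
    exact hv i
  simp [f, this]

lemma EW_lower {d : ℕ} (μ : Measure (Vd d)) [IsProbabilityMeasure μ]
    (hint : Integrable (fun v : Vd d => ‖v‖ ^ 2) μ) {N : ℕ} (hN : 0 < N)
    {Ω : Type} [MeasurableSpace Ω] (P : Measure Ω) [IsProbabilityMeasure P]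
    (Vs : Fin N → Ω → Vd d) (hVm : ∀ i, Measurable (Vs i)) (hVμ : ∀ i, P.map (Vs i) = μ)
    (B : Set (Vd d)) (hB : MeasurableSet B)
    (hsm : ∀ v ∈ B, N * μ (Metric.ball v 1) ≤ 2⁻¹) :
    ∫⁻ v in B, ENNReal.ofReal (1 + ‖v‖ ^ 2) * 2⁻¹ ∂μ ≤
    ∫⁻ ω, ENNReal.ofReal (Wdist (empMeasure Vs ω) μ) ∂P := by
  let T : Set (Ω × Vd d) := {z | ∀ i, 1 ≤ dist z.2 (Vs i z.1)}
  have hT : MeasurableSet T := by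
    have : T = ⋂ i, {z : Ω × Vd d | 1 ≤ dist z.2 (Vs i z.1)} := by
      ext z; simp [T]
    rw [this]
    refine MeasurableSet.iInter fun i => measurableSet_le measurable_const ?_
    exact measurable_snd.dist ((hVm i).comp measurable_fst)
  let G : Ω → Vd d → ℝ≥0∞ := fun ω v => T.indicator (fun z => ENNReal.ofReal (1 + ‖z.2‖ ^ 2)) (ω, v)
  have hG : Measurable (Function.uncurry G) := by
    refine Measurable.indicator ?_ hT
    fun_prop
  have hstep : ∀ ω, ∫⁻ v, G ω v ∂μ ≤ ENNReal.ofReal (Wdist (empMeasure Vs ω) μ) := by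
    intro ω
    exact W_lower μ hint hN (fun i => Vs i ω)
  refine le_trans ?_ (lintegral_mono hstep)
  rw [lintegral_lintegral_swap hG.aemeasurable]
  refine le_trans ?_ (setLIntegral_le_lintegral B _)
  refine setLIntegral_mono' hB fun v hv => ?_
  have hTv : MeasurableSet {ω | (ω, v) ∈ T} := hT.preimage (measurable_id.prodMk measurable_const)
  have e : ∀ ω, G ω v = {ω | (ω, v) ∈ T}.indicator (fun _ => ENNReal.ofReal (1 + ‖v‖ ^ 2)) ω := by
    intro ω
    rfl
  simp_rw [e]
  rw [lintegral_indicator_const hTv]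
  gcongr
  have hc : P {ω | (ω, v) ∈ T}ᶜ ≤ 2⁻¹ := by
    refine le_trans ?_ (hsm v hv)
    have : {ω | (ω, v) ∈ T}ᶜ ⊆ ⋃ i, Vs i ⁻¹' Metric.ball v 1 := by
      intro ω hω
      simpa [T, dist_comm] using hω
    refine (measure_mono this).trans ((measure_iUnion_fintype_le _ _).trans ?_)
    have : ∀ i, P (Vs i ⁻¹' Metric.ball v 1) = μ (Metric.ball v 1) := by
      intro i
      rw [← hVμ i, Measure.map_apply (hVm i) measurableSet_ball]
    simp [this]
  have h1 := prob_add_prob_compl (μ := P) hTv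
  by_contra! hlt
  have : P {ω | (ω, v) ∈ T} + P {ω | (ω, v) ∈ T}ᶜ < 2⁻¹ + 2⁻¹ :=
    ENNReal.add_lt_add_of_lt_of_le (by finiteness) hlt hc
  rw [h1, ENNReal.inv_two_add_inv_two] at this
  exact lt_irrefl _ this

lemma moment_fin {d : ℕ} {p q c r : ℝ} (hp : 2 < p) (hq : (d : ℝ) + p < q) (hc : 0 < c)
    (hr : 0 < r) :
    momentL p (MeasureTheory.volume.withDensity
        (fun v : Vd d => ENNReal.ofReal (if r < ‖v‖ then c * ‖v‖ ^ (-q) else 0))) ≠ ⊤ := by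
  have hm : Measurable (fun v : Vd d => ENNReal.ofReal (if r < ‖v‖ then c * ‖v‖ ^ (-q) else 0)) := by
    refine ENNReal.measurable_ofReal.comp (Measurable.ite ?_ ?_ measurable_const)
    · exact measurableSet_lt measurable_const measurable_norm
    · fun_prop
  unfold momentL
  rw [lintegral_withDensity_eq_lintegral_mul _ hm (by fun_prop)]
  have hfin := finite_integral_one_add_norm (E := Vd d) (μ := volume) (r := q - p)
    (by simp; linarith)
  set C : ℝ := c * (1 + 1 / r) ^ (q - p)
  have hC : 0 ≤ C := by positivity
  refine ne_top_of_le_ne_top (b := ENNReal.ofReal C * ∫⁻ x : Vd d, ENNReal.ofReal ((1 + ‖x‖) ^ (-(q - p)))) (ENNReal.mul_ne_top (by simp) hfin.ne) ?_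
  rw [← lintegral_const_mul _ (by fun_prop)]
  refine lintegral_mono fun v => ?_
  simp only [Pi.mul_apply]
  split_ifs with hv
  · have hv0 : 0 < ‖v‖ := hr.trans hv
    have : (‖v‖₊ : ℝ≥0∞) ^ p = ENNReal.ofReal (‖v‖ ^ p) := by
      rw [← ENNReal.ofReal_rpow_of_pos hv0, ofReal_norm]; rfl
    rw [this, ← ENNReal.ofReal_mul (by positivity), ← ENNReal.ofReal_mul hC]
    refine ENNReal.ofReal_le_ofReal ?_
    have h1 : 1 + ‖v‖ ≤ (1 + 1 / r) * ‖v‖ := by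
      have : 1 ≤ 1 / r * ‖v‖ := by
        rw [one_div, inv_mul_eq_div, one_le_div hr]; exact hv.le
      linarith
    have h2 : (1 + ‖v‖) ^ (q - p) ≤ (1 + 1 / r) ^ (q - p) * ‖v‖ ^ (q - p) := by
      rw [← Real.mul_rpow (by positivity) (by positivity)]
      exact Real.rpow_le_rpow (by positivity) h1 (by linarith [(Nat.cast_nonneg d : (0:ℝ) ≤ d)])
    have h3 : ‖v‖ ^ (-q) * ‖v‖ ^ p = (‖v‖ ^ (q - p))⁻¹ := by
      rw [← Real.rpow_add hv0, ← Real.rpow_neg hv0.le]; congr 1; ring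
    rw [mul_assoc, h3, Real.rpow_neg (by positivity)]
    simp only [C]
    rw [mul_assoc]
    refine mul_le_mul_of_nonneg_left ?_ hc.le
    rw [← div_eq_mul_inv, le_div_iff₀ (by positivity), inv_mul_eq_div, div_le_iff₀ (by positivity)]
    exact h2
  · simp

/-- Optimality of the empirical approximation rate: for the heavy-tailed law
`μ(dv) = c 1_{|v|>r} |v|^{-q} dv` in 𝒮, the expected W-distance of the N-sample
empirical distribution from μ is at least of order `N^{-1+(d+2)/q}`. -/
theorem empirical_W_lower_bound
    (d : ℕ) (hd : 2 ≤ d) (p q : ℝ) (hp : 2 < p) (hq : (d : ℝ) + p < q)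
    (c r : ℝ) (hc : 0 < c) (hr : 0 < r)
    (hμS : (MeasureTheory.volume.withDensity
        (fun v : Vd d => ENNReal.ofReal (if r < ‖v‖ then c * ‖v‖ ^ (-q) else 0)))
      ∈ boltzmannSphere d) :
    momentL p (MeasureTheory.volume.withDensity
        (fun v : Vd d => ENNReal.ofReal (if r < ‖v‖ then c * ‖v‖ ^ (-q) else 0))) ≠ ⊤ ∧
    ∃ c' : ℝ, 0 < c' ∧
      ∀ (Ω : Type) (m : MeasurableSpace Ω) (P : Measure Ω),
        IsProbabilityMeasure P →
      ∀ (N : ℕ) (Vs : Fin N → Ω → Vd d),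
        (∀ i, Measurable (Vs i)) →
        iIndepFun Vs P →
        (∀ i, P.map (Vs i) = MeasureTheory.volume.withDensity
          (fun v : Vd d => ENNReal.ofReal (if r < ‖v‖ then c * ‖v‖ ^ (-q) else 0))) →
        ENNReal.ofReal (c' * (N : ℝ) ^ (-1 + ((d : ℝ) + 2) / q)) ≤
          ∫⁻ ω, ENNReal.ofReal (Wdist (empMeasure Vs ω)
            (MeasureTheory.volume.withDensity
              (fun v : Vd d => ENNReal.ofReal (if r < ‖v‖ then c * ‖v‖ ^ (-q) else 0)))) ∂P := by
  have hm : Measurable (fun v : Vd d => ENNReal.ofReal (if r < ‖v‖ then c * ‖v‖ ^ (-q) else 0)) := by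
    refine ENNReal.measurable_ofReal.comp (Measurable.ite ?_ ?_ measurable_const)
    · exact measurableSet_lt measurable_const measurable_norm
    · fun_prop
  refine ⟨moment_fin hp hq hc hr, ?_⟩
  set ρ : Vd d → ℝ≥0∞ :=
    fun v : Vd d => ENNReal.ofReal (if r < ‖v‖ then c * ‖v‖ ^ (-q) else 0) with hρ
  set μ := (MeasureTheory.volume.withDensity ρ : Measure (Vd d)) with hμ
  obtain ⟨hprob, -, h2⟩ := hμS
  have hint : Integrable (fun v : Vd d => ‖v‖ ^ 2) μ := by
    by_contra h
    rw [integral_undef h] at h2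
    norm_num at h2
  have hd0 : (0:ℝ) ≤ d := Nat.cast_nonneg d
  have hq0 : 0 < q := by linarith
  set w : ℝ := (volume (Metric.ball (0 : Vd d) 1)).toReal with hw
  have hwfin : volume (Metric.ball (0 : Vd d) 1) ≠ ⊤ := measure_ball_lt_top.ne
  have hw0 : 0 < w := ENNReal.toReal_pos (Metric.measure_ball_pos _ _ one_pos).ne' hwfin
  have hwE : volume (Metric.ball (0 : Vd d) 1) = ENNReal.ofReal w :=
    (ENNReal.ofReal_toReal hwfin).symm
  set K : ℝ := max (max 1 r) ((2 * c * w) ^ (1 / q)) with hK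
  have hK1 : 1 ≤ K := (le_max_left _ _).trans (le_max_left _ _)
  have hKr : r ≤ K := (le_max_right _ _).trans (le_max_left _ _)
  have hK0 : 0 < K := by linarith
  have hKq : 2 * c * w ≤ K ^ q := by
    have : ((2 * c * w) ^ (1 / q)) ^ q ≤ K ^ q :=
      Real.rpow_le_rpow (by positivity) (le_max_right _ _) hq0.le
    rwa [← Real.rpow_mul (by positivity), one_div_mul_cancel hq0.ne', Real.rpow_one] at this
  have hfr : Module.finrank ℝ (Vd d) = d := by simp
  obtain ⟨e, he⟩ : ∃ e : Vd d, ‖e‖ = 1 :=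
    ⟨EuclideanSpace.single ⟨0, by omega⟩ 1, by simp⟩
  refine ⟨c * 4 ^ (-q) * 2 * w * K ^ ((d:ℝ) + 2 - q), by positivity, ?_⟩
  intro Ω m P hP N Vs hVm _ hVμ
  rcases Nat.eq_zero_or_pos N with hN | hN
  · have : -1 + ((d:ℝ) + 2) / q ≠ 0 := by
      have : ((d:ℝ) + 2) / q < 1 := by rw [div_lt_one hq0]; linarith
      linarith
    subst hN
    simp [Real.zero_rpow this]
  have hN1 : (1:ℝ) ≤ N := by exact_mod_cast hN
  have hNpos : (0:ℝ) < N := by linarith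
  set A : ℝ := K * (N:ℝ) ^ (1 / q) with hA
  have hAK : K ≤ A := le_mul_of_one_le_right hK0.le (Real.one_le_rpow hN1 (by positivity))
  have hA0 : 0 < A := by linarith
  have hAq : A ^ q = K ^ q * N := by
    rw [hA, Real.mul_rpow hK0.le (by positivity), ← Real.rpow_mul hNpos.le,
      one_div_mul_cancel hq0.ne', Real.rpow_one]
  set B : Set (Vd d) := Metric.ball ((3 * A) • e) A with hB
  have hBn : ∀ v ∈ B, 2 * A < ‖v‖ ∧ ‖v‖ < 4 * A := by
    intro v hv
    rw [hB, mem_ball_iff_norm] at hv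
    have hn : ‖(3 * A) • e‖ = 3 * A := by
      rw [norm_smul, he, mul_one, Real.norm_of_nonneg (by positivity)]
    have a := norm_sub_norm_le v ((3 * A) • e)
    have b := norm_sub_norm_le ((3 * A) • e) v
    rw [norm_sub_rev] at b
    constructor <;> linarith
  have hsm : ∀ v ∈ B, N * μ (Metric.ball v 1) ≤ 2⁻¹ := by
    intro v hv
    have hv2 := (hBn v hv).1
    have h1 : μ (Metric.ball v 1) ≤ ENNReal.ofReal (c * A ^ (-q)) * ENNReal.ofReal w := by
      rw [hμ, withDensity_apply _ measurableSet_ball]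
      calc ∫⁻ x in Metric.ball v 1, ρ x ≤ ∫⁻ x in Metric.ball v 1, ENNReal.ofReal (c * A ^ (-q)) := by
            refine setLIntegral_mono' measurableSet_ball fun x hx => ?_
            rw [mem_ball_iff_norm'] at hx
            have a := norm_sub_norm_le v x
            have hxA : A ≤ ‖x‖ := by linarith
            refine ENNReal.ofReal_le_ofReal ?_
            split_ifs
            · exact mul_le_mul_of_nonneg_left
                (Real.rpow_le_rpow_of_nonpos hA0 hxA (by linarith)) hc.le
            · positivity
        _ = _ := by
            rw [setLIntegral_const, Measure.addHaar_ball_center, hwE]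
    calc (N:ℝ≥0∞) * μ (Metric.ball v 1)
        ≤ ENNReal.ofReal N * (ENNReal.ofReal (c * A ^ (-q)) * ENNReal.ofReal w) := by
          rw [ENNReal.ofReal_natCast]; gcongr
      _ = ENNReal.ofReal (N * (c * A ^ (-q) * w)) := by
          rw [← ENNReal.ofReal_mul (by positivity), ← ENNReal.ofReal_mul (by positivity)]
      _ ≤ ENNReal.ofReal (2⁻¹) := by
          refine ENNReal.ofReal_le_ofReal ?_
          rw [Real.rpow_neg hA0.le, hAq]
          have : (N:ℝ) * (c * (K ^ q * N)⁻¹ * w) = (c * w) / K ^ q := by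
            field_simp
          rw [this, div_le_iff₀ (by positivity)]
          linarith
      _ = 2⁻¹ := by
          rw [ENNReal.ofReal_inv_of_pos two_pos]; simp
  refine le_trans ?_ (EW_lower μ hint hN P Vs hVm hVμ B measurableSet_ball hsm)
  rw [hμ, restrict_withDensity measurableSet_ball,
    lintegral_withDensity_eq_lintegral_mul _ hm (by fun_prop)]
  calc ENNReal.ofReal (c * 4 ^ (-q) * 2 * w * K ^ ((d:ℝ) + 2 - q) * (N : ℝ) ^ (-1 + ((d : ℝ) + 2) / q))
      = ENNReal.ofReal (c * (4 * A) ^ (-q) * ((2 * A) ^ 2 * 2⁻¹)) * volume B := by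
        rw [hB, Measure.addHaar_ball_of_pos _ _ hA0, hwE, hfr, ← ENNReal.ofReal_mul (by positivity),
          ← ENNReal.ofReal_mul (by positivity)]
        congr 1
        have e1 : A ^ ((d:ℝ) + 2 - q) = K ^ ((d:ℝ) + 2 - q) * (N : ℝ) ^ (-1 + ((d : ℝ) + 2) / q) := by
          rw [hA, Real.mul_rpow hK0.le (by positivity), ← Real.rpow_mul hNpos.le]
          congr 2
          field_simp
          ring
        have e2 : A ^ ((d:ℝ) + 2 - q) = A ^ d * A ^ 2 * A ^ (-q) := by
          rw [sub_eq_add_neg, Real.rpow_add hA0, Real.rpow_add hA0, Real.rpow_natCast]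
          norm_num
        rw [mul_assoc _ (K ^ _), ← e1, e2, Real.mul_rpow (by norm_num) hA0.le]
        ring
    _ = ∫⁻ v in B, ENNReal.ofReal (c * (4 * A) ^ (-q) * ((2 * A) ^ 2 * 2⁻¹)) := by
        rw [setLIntegral_const]
    _ ≤ _ := by
        refine setLIntegral_mono' measurableSet_ball fun v hv => ?_
        obtain ⟨a, b⟩ := hBn v hv
        have hrv : r < ‖v‖ := by linarith
        have hv0 : 0 < ‖v‖ := by linarith
        simp only [Pi.mul_apply, hρ, if_pos hrv]
        have : (2⁻¹ : ℝ≥0∞) = ENNReal.ofReal 2⁻¹ := by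
          rw [ENNReal.ofReal_inv_of_pos two_pos]; simp
        rw [this, ← ENNReal.ofReal_mul (by positivity), ← ENNReal.ofReal_mul (by positivity)]
        refine ENNReal.ofReal_le_ofReal ?_
        have i1 : (4 * A) ^ (-q) ≤ ‖v‖ ^ (-q) :=
          Real.rpow_le_rpow_of_nonpos hv0 b.le (by linarith)
        have i2 : (2 * A) ^ 2 ≤ 1 + ‖v‖ ^ 2 := by nlinarith
        gcongr
end
end
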